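/- Let p > 3 be prime and let u₂, u₃ ∈ 𝔽_p with u₃ ≠ 0. Consider the regular subgroup H = ⟨ρ, σα₁, σ^{u₂}τ^{u₃}α₃⟩ of Hol(M₁), and let S be the stabilizer of H under the conjugation action of Aut(M₁) on subgroups of Hol(M₁). Then: |S| = (p − 1)p³ if u₂² − 4u₃ = 0 in 𝔽_p; |S| = (p − 1)²p² if u₂² − 4u₃ is a nonzero square in 𝔽_p; and |S| = (p² − 1)p² if u₂² − 4u₃ is a non-square in 𝔽_p. -/

import Mathlib

/-! ## The Heisenberg group of order `p³` -/

@[ext]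
structure Heisenberg (p : ℕ) where
  x : ZMod p
  y : ZMod p
  z : ZMod p

namespace Heisenberg

variable {p : ℕ}

instance : Mul (Heisenberg p) :=
  ⟨fun g h => ⟨g.x + h.x, g.y + h.y, g.z + h.z + h.x * g.y⟩⟩

instance : One (Heisenberg p) := ⟨⟨0, 0, 0⟩⟩

instance : Inv (Heisenberg p) := ⟨fun g => ⟨-g.x, -g.y, -g.z + g.x * g.y⟩⟩

@[simp] theorem mul_x (g h : Heisenberg p) : (g * h).x = g.x + h.x := rfl
@[simp] theorem mul_y (g h : Heisenberg p) : (g * h).y = g.y + h.y := rfl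
@[simp] theorem mul_z (g h : Heisenberg p) : (g * h).z = g.z + h.z + h.x * g.y := rfl
@[simp] theorem one_x : (1 : Heisenberg p).x = 0 := rfl
@[simp] theorem one_y : (1 : Heisenberg p).y = 0 := rfl
@[simp] theorem one_z : (1 : Heisenberg p).z = 0 := rfl
@[simp] theorem inv_x (g : Heisenberg p) : (g⁻¹).x = -g.x := rfl
@[simp] theorem inv_y (g : Heisenberg p) : (g⁻¹).y = -g.y := rfl
@[simp] theorem inv_z (g : Heisenberg p) : (g⁻¹).z = -g.z + g.x * g.y := rfl

instance : Group (Heisenberg p) where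
  mul_assoc a b c := by ext <;> simp <;> ring
  one_mul a := by ext <;> simp
  mul_one a := by ext <;> simp
  inv_mul_cancel a := by ext <;> simp <;> ring

/-- The generator `ρ` (a generator of the centre). -/
def ρ : Heisenberg p := ⟨0, 0, 1⟩

/-- The generator `σ`. -/
def σ : Heisenberg p := ⟨1, 0, 0⟩

/-- The generator `τ`. -/
def τ : Heisenberg p := ⟨0, 1, 0⟩

/-- The automorphism `α₁` determined by `σ ↦ ρσ`, `τ ↦ τ` (and `ρ ↦ ρ`). -/
def α₁ : MulAut (Heisenberg p) where
  toFun g := ⟨g.x, g.y, g.z + g.x⟩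
  invFun g := ⟨g.x, g.y, g.z - g.x⟩
  left_inv g := by ext <;> simp
  right_inv g := by ext <;> simp
  map_mul' g h := by ext <;> simp <;> ring

/-- The automorphism `α₃` determined by `σ ↦ σ`, `τ ↦ ρτ` (and `ρ ↦ ρ`). -/
def α₃ : MulAut (Heisenberg p) where
  toFun g := ⟨g.x, g.y, g.z + g.y⟩
  invFun g := ⟨g.x, g.y, g.z - g.y⟩
  left_inv g := by ext <;> simp
  right_inv g := by ext <;> simp
  map_mul' g h := by ext <;> simp <;> ring

/-- The automorphism `α₂` determined by `σ ↦ στ`, `τ ↦ τ` (and `ρ ↦ ρ`), for `p` an odd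
prime. -/
def α₂ (p : ℕ) [Fact p.Prime] (hp : p ≠ 2) : MulAut (Heisenberg p) where
  toFun g := ⟨g.x, g.x + g.y, g.z + g.x * (g.x - 1) / 2⟩
  invFun g := ⟨g.x, g.y - g.x, g.z - g.x * (g.x - 1) / 2⟩
  left_inv g := by ext <;> simp <;> ring
  right_inv g := by ext <;> simp <;> ring
  map_mul' g h := by
    have h2 : (2 : ZMod p) ≠ 0 := by
      intro h
      have h' : ((2 : ℕ) : ZMod p) = 0 := by exact_mod_cast h
      rw [CharP.cast_eq_zero_iff (ZMod p) p 2] at h'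
      have h1 := Nat.le_of_dvd (by norm_num) h'
      have h2 := (Fact.out : p.Prime).two_le
      omega
    ext <;> simp
    · ring
    · field_simp
      ring

end Heisenberg

open Heisenberg

/-! ## The holomorph of `M₁` inside the permutation group -/

/-- The left regular representation `M₁ → Perm M₁`. -/
def leftMulHom (p : ℕ) : Heisenberg p →* Equiv.Perm (Heisenberg p) :=
  MulAction.toPermHom (Heisenberg p) (Heisenberg p)

/-- The holomorph of `M₁`, realized as the subgroup of `Perm M₁` generated by left
translations and automorphisms of `M₁`. -/
def Hol (p : ℕ) : Subgroup (Equiv.Perm (Heisenberg p)) :=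
  (leftMulHom p).range ⊔
    (MulAut.toPerm (Heisenberg p)).range

/-- A subgroup of `Perm X` is regular if it acts freely and transitively on `X`. -/
def IsRegularSub {X : Type*} (H : Subgroup (Equiv.Perm X)) : Prop :=
  ∀ x y : X, ∃! g : Equiv.Perm X, g ∈ H ∧ g x = y

/-- The canonical projection `Θ : Hol(M₁) → Aut(M₁)` (with kernel the left translations),
written as a function on permutations: it sends `π` to `m ↦ (π 1)⁻¹ * π m`; on elements of the
holomorph, this is exactly the automorphism component. -/
def theta (p : ℕ) (π : Equiv.Perm (Heisenberg p)) : Equiv.Perm (Heisenberg p) :=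
  (Equiv.mulLeft (π 1))⁻¹ * π

/-- The cardinality of the image `Θ(G)` of a subgroup `G` of the holomorph under the canonical
projection `Θ`. -/
noncomputable def thetaCard (p : ℕ) (G : Subgroup (Equiv.Perm (Heisenberg p))) : ℕ :=
  Nat.card (theta p '' (G : Set (Equiv.Perm (Heisenberg p))))

/-- The conjugation action of `Aut(M₁)` (viewed inside `Perm M₁`) on subgroups of `Perm M₁`. -/
def autConj (p : ℕ) (α : MulAut (Heisenberg p)) (G : Subgroup (Equiv.Perm (Heisenberg p))) :
    Subgroup (Equiv.Perm (Heisenberg p)) :=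
  Subgroup.map (MulAut.conj (MulAut.toPerm (Heisenberg p) α)).toMonoidHom G


namespace Heisenberg

variable {p : ℕ}

instance [NeZero p] : Finite (Heisenberg p) :=
  Finite.of_injective (fun g : Heisenberg p => (g.x, g.y, g.z)) fun g h hgh => by
    simp only [Prod.mk.injEq] at hgh
    exact Heisenberg.ext hgh.1 hgh.2.1 hgh.2.2

theorem two_ne_zero_zmod [Fact p.Prime] (hp : p ≠ 2) : (2 : ZMod p) ≠ 0 := by
  refine Ring.two_ne_zero ?_
  rwa [ZMod.ringChar_zmod_n]

theorem σ_pow (n : ℕ) : (σ : Heisenberg p) ^ n = ⟨n, 0, 0⟩ := by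
  induction n with
  | zero => ext <;> simp
  | succ n ih => rw [pow_succ, ih]; ext <;> simp [σ]

theorem τ_pow (n : ℕ) : (τ : Heisenberg p) ^ n = ⟨0, n, 0⟩ := by
  induction n with
  | zero => ext <;> simp
  | succ n ih => rw [pow_succ, ih]; ext <;> simp [τ]

theorem ρ_pow (n : ℕ) : (ρ : Heisenberg p) ^ n = ⟨0, 0, n⟩ := by
  induction n with
  | zero => ext <;> simp
  | succ n ih => rw [pow_succ, ih]; ext <;> simp [ρ]

theorem ρ_eq_commutator : (ρ : Heisenberg p) = τ * σ * (σ * τ)⁻¹ := by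
  ext <;> simp [ρ, σ, τ]

theorem closure_σ_τ [NeZero p] : Subgroup.closure {(σ : Heisenberg p), τ} = ⊤ := by
  refine eq_top_iff.2 fun g _ => ?_
  have hσ : (σ : Heisenberg p) ∈ Subgroup.closure {(σ : Heisenberg p), τ} :=
    Subgroup.subset_closure (by simp)
  have hτ : (τ : Heisenberg p) ∈ Subgroup.closure {(σ : Heisenberg p), τ} :=
    Subgroup.subset_closure (by simp)
  have hρ : (ρ : Heisenberg p) ∈ Subgroup.closure {(σ : Heisenberg p), τ} := by
    rw [ρ_eq_commutator]
    exact mul_mem (mul_mem hτ hσ) (inv_mem (mul_mem hσ hτ))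
  have hg : g = σ ^ g.x.val * τ ^ g.y.val * ρ ^ g.z.val := by
    rw [σ_pow, τ_pow, ρ_pow]; ext <;> simp
  rw [hg]
  exact mul_mem (mul_mem (pow_mem hσ _) (pow_mem hτ _)) (pow_mem hρ _)

/-- The endomorphism of the Heisenberg group inducing the matrix `!![a, b; c, d]` modulo the
centre, with linear part `l x + m y` in the central coordinate. -/
def endo [Fact p.Prime] (hp : p ≠ 2) (a b c d l m : ZMod p) : Heisenberg p →* Heisenberg p where
  toFun g := ⟨a * g.x + b * g.y, c * g.x + d * g.y, (a * d - b * c) * g.z +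
    (a * c * g.x ^ 2 + b * d * g.y ^ 2) / 2 + b * c * g.x * g.y + l * g.x + m * g.y⟩
  map_one' := by ext <;> simp
  map_mul' g h := by
    have h2 := two_ne_zero_zmod hp
    ext <;> simp only [mul_x, mul_y, mul_z]
    · ring
    · ring
    · field_simp
      ring

theorem endo_injective [Fact p.Prime] (hp : p ≠ 2) {a b c d : ZMod p} (l m : ZMod p)
    (hD : a * d - b * c ≠ 0) : Function.Injective (endo hp a b c d l m) := by
  refine (injective_iff_map_eq_one _).2 fun g hg => ?_
  have hx : a * g.x + b * g.y = 0 := congrArg Heisenberg.x hg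
  have hy : c * g.x + d * g.y = 0 := congrArg Heisenberg.y hg
  have hz : (a * d - b * c) * g.z + (a * c * g.x ^ 2 + b * d * g.y ^ 2) / 2 +
      b * c * g.x * g.y + l * g.x + m * g.y = 0 := congrArg Heisenberg.z hg
  have gx : g.x = 0 := (mul_eq_zero.1 (show (a * d - b * c) * g.x = 0 by
    linear_combination d * hx - b * hy)).resolve_left hD
  have gy : g.y = 0 := (mul_eq_zero.1 (show (a * d - b * c) * g.y = 0 by
    linear_combination a * hy - c * hx)).resolve_left hD
  have gz : g.z = 0 := by simpa [gx, gy, hD] using hz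
  exact Heisenberg.ext gx gy gz

/-- The automorphism underlying `endo` when the determinant is nonzero. -/
noncomputable def auto [Fact p.Prime] (hp : p ≠ 2) (a b c d l m : ZMod p)
    (hD : a * d - b * c ≠ 0) : MulAut (Heisenberg p) :=
  MulEquiv.ofBijective (endo hp a b c d l m)
    (Finite.injective_iff_bijective.1 (endo_injective hp l m hD))

theorem auto_apply [Fact p.Prime] (hp : p ≠ 2) (a b c d l m : ZMod p)
    (hD : a * d - b * c ≠ 0) (g : Heisenberg p) : auto hp a b c d l m hD g =
      ⟨a * g.x + b * g.y, c * g.x + d * g.y, (a * d - b * c) * g.z +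
        (a * c * g.x ^ 2 + b * d * g.y ^ 2) / 2 + b * c * g.x * g.y + l * g.x + m * g.y⟩ := rfl

theorem exists_eq_auto [Fact p.Prime] (hp : p ≠ 2) (α : MulAut (Heisenberg p)) :
    ∃ (a b c d l m : ZMod p) (hD : a * d - b * c ≠ 0), α = auto hp a b c d l m hD := by
  have hD : (α σ).x * (α τ).y - (α τ).x * (α σ).y ≠ 0 := by
    intro h
    have h1 : α ρ = 1 := by
      rw [ρ_eq_commutator, map_mul, map_inv, map_mul, map_mul]
      ext <;> simp only [mul_x, mul_y, mul_z, inv_x, inv_y, inv_z, one_x, one_y, one_z]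
      · ring
      · ring
      · linear_combination h
    have h2 : (ρ : Heisenberg p) = 1 := (map_eq_one_iff α α.injective).1 h1
    exact one_ne_zero (congrArg Heisenberg.z h2 : (1 : ZMod p) = 0)
  refine ⟨(α σ).x, (α τ).x, (α σ).y, (α τ).y, (α σ).z - (α σ).x * (α σ).y / 2,
    (α τ).z - (α τ).x * (α τ).y / 2, hD, ?_⟩
  refine MulEquiv.toMonoidHom_injective (MonoidHom.eq_of_eqOn_dense closure_σ_τ ?_)
  rintro g (rfl | rfl)
  · change α σ = auto hp _ _ _ _ _ _ hD σ
    rw [auto_apply]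
    ext <;> simp [σ]
  · change α τ = auto hp _ _ _ _ _ _ hD τ
    rw [auto_apply]
    ext <;> simp [τ]

/-- The permutations making up the regular subgroup `⟨ρ, σα₁, σ^{u₂}τ^{u₃}α₃⟩`. -/
def shear (u₂ u₃ s t r : ZMod p) : Equiv.Perm (Heisenberg p) where
  toFun g := ⟨g.x + (s + u₂ * t), g.y + u₃ * t, g.z + (s + u₃ * t) * g.x + t * g.y + r⟩
  invFun g := ⟨g.x - (s + u₂ * t), g.y - u₃ * t,
    g.z - (s + u₃ * t) * (g.x - (s + u₂ * t)) - t * (g.y - u₃ * t) - r⟩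
  left_inv g := by ext <;> simp <;> ring
  right_inv g := by ext <;> simp <;> ring

theorem shear_apply (u₂ u₃ s t r : ZMod p) (g : Heisenberg p) : shear u₂ u₃ s t r g =
    ⟨g.x + (s + u₂ * t), g.y + u₃ * t, g.z + (s + u₃ * t) * g.x + t * g.y + r⟩ := rfl

theorem shear_zero (u₂ u₃ : ZMod p) : shear u₂ u₃ 0 0 0 = 1 := by
  ext g <;> simp [shear_apply]

theorem shear_mul (u₂ u₃ s t r s' t' r' : ZMod p) :
    shear u₂ u₃ s t r * shear u₂ u₃ s' t' r' = shear u₂ u₃ (s + s') (t + t')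
      (r + r' + (s + u₃ * t) * (s' + u₂ * t') + t * (u₃ * t')) := by
  ext g <;> simp only [Equiv.Perm.mul_apply, shear_apply] <;> ring

/-- The subgroup of all `shear u₂ u₃ s t r`. -/
def shearSubgroup (u₂ u₃ : ZMod p) : Subgroup (Equiv.Perm (Heisenberg p)) where
  carrier := {π | ∃ s t r, π = shear u₂ u₃ s t r}
  mul_mem' := by
    rintro _ _ ⟨s, t, r, rfl⟩ ⟨s', t', r', rfl⟩
    exact ⟨_, _, _, shear_mul ..⟩
  one_mem' := ⟨0, 0, 0, (shear_zero u₂ u₃).symm⟩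
  inv_mem' := by
    rintro _ ⟨s, t, r, rfl⟩
    refine ⟨-s, -t, -r + (s + u₃ * t) * (s + u₂ * t) + t * (u₃ * t), ?_⟩
    rw [inv_eq_iff_mul_eq_one, shear_mul, ← shear_zero u₂ u₃]
    congr 1 <;> ring

theorem mem_shearSubgroup {u₂ u₃ : ZMod p} {π : Equiv.Perm (Heisenberg p)} :
    π ∈ shearSubgroup u₂ u₃ ↔ ∃ s t r, π = shear u₂ u₃ s t r := Iff.rfl

theorem shear_pow (u₂ u₃ s t r : ZMod p) (n : ℕ) :
    ∃ r', shear u₂ u₃ s t r ^ n = shear u₂ u₃ (n * s) (n * t) r' := by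
  induction n with
  | zero => exact ⟨0, by simp [shear_zero]⟩
  | succ n ih =>
    obtain ⟨r', hr⟩ := ih
    rw [pow_succ, hr, shear_mul, Nat.cast_succ, add_one_mul, add_one_mul]
    exact ⟨_, rfl⟩

theorem shear_central_pow (u₂ u₃ : ZMod p) (n : ℕ) :
    shear u₂ u₃ 0 0 1 ^ n = shear u₂ u₃ 0 0 n := by
  induction n with
  | zero => simp [shear_zero]
  | succ n ih => rw [pow_succ, ih, shear_mul]; congr 1 <;> simp

theorem leftMulHom_apply (g h : Heisenberg p) : leftMulHom p g h = g * h := rfl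

theorem toPerm_apply (α : MulAut (Heisenberg p)) (g : Heisenberg p) :
    MulAut.toPerm (Heisenberg p) α g = α g := rfl

theorem α₁_apply (g : Heisenberg p) : α₁ g = ⟨g.x, g.y, g.z + g.x⟩ := rfl

theorem α₃_apply (g : Heisenberg p) : α₃ g = ⟨g.x, g.y, g.z + g.y⟩ := rfl

theorem closure_eq_shearSubgroup [NeZero p] (u₂ u₃ : ZMod p) :
    Subgroup.closure {leftMulHom p ρ,
      leftMulHom p σ * MulAut.toPerm (Heisenberg p) α₁,
      leftMulHom p (σ ^ u₂.val * τ ^ u₃.val) * MulAut.toPerm (Heisenberg p) α₃} =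
    shearSubgroup u₂ u₃ := by
  have h₁ : leftMulHom p ρ = shear u₂ u₃ 0 0 1 := by
    ext g <;> simp only [leftMulHom_apply, shear_apply, mul_x, mul_y, mul_z, ρ] <;> ring
  have h₂ : leftMulHom p σ * MulAut.toPerm (Heisenberg p) α₁ = shear u₂ u₃ 1 0 0 := by
    ext g <;> simp only [Equiv.Perm.mul_apply, leftMulHom_apply, toPerm_apply, shear_apply,
      α₁_apply, mul_x, mul_y, mul_z, σ] <;> ring
  have h₃ : leftMulHom p (σ ^ u₂.val * τ ^ u₃.val) * MulAut.toPerm (Heisenberg p) α₃ =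
      shear u₂ u₃ 0 1 0 := by
    ext g <;> simp only [Equiv.Perm.mul_apply, leftMulHom_apply, toPerm_apply, shear_apply,
      α₃_apply, mul_x, mul_y, mul_z, σ_pow, τ_pow, ZMod.natCast_zmod_val] <;> ring
  rw [h₁, h₂, h₃]
  refine le_antisymm ((Subgroup.closure_le _).2 ?_) ?_
  · rintro _ (rfl | rfl | rfl) <;> exact ⟨_, _, _, rfl⟩
  · rintro _ ⟨s, t, r, rfl⟩
    obtain ⟨r₁, hr₁⟩ := shear_pow u₂ u₃ 1 0 0 s.val
    obtain ⟨r₂, hr₂⟩ := shear_pow u₂ u₃ 0 1 0 t.val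
    have key : shear u₂ u₃ s t r = shear u₂ u₃ 0 0 1 ^ (r - (r₁ + r₂ + s * (u₂ * t))).val *
        (shear u₂ u₃ 1 0 0 ^ s.val * shear u₂ u₃ 0 1 0 ^ t.val) := by
      rw [hr₁, hr₂, shear_central_pow, shear_mul, shear_mul]
      simp only [ZMod.natCast_val, ZMod.cast_id', id]
      congr 1 <;> ring
    rw [key]
    exact mul_mem (pow_mem (Subgroup.subset_closure (by simp)) _)
      (mul_mem (pow_mem (Subgroup.subset_closure (by simp)) _)
        (pow_mem (Subgroup.subset_closure (by simp)) _))

theorem autConj_eq_iff [NeZero p] (α : MulAut (Heisenberg p))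
    (G : Subgroup (Equiv.Perm (Heisenberg p))) :
    autConj p α G = G ↔ ∀ π ∈ G, ∃ π' ∈ G, ∀ g, α (π g) = π' (α g) := by
  have conj_eq (π π' : Equiv.Perm (Heisenberg p)) :
      MulAut.conj (MulAut.toPerm (Heisenberg p) α) π = π' ↔ ∀ g, α (π g) = π' (α g) := by
    rw [MulAut.conj_apply, mul_inv_eq_iff_eq_mul, Equiv.ext_iff]
    rfl
  constructor
  · intro h π hπ
    refine ⟨MulAut.conj (MulAut.toPerm (Heisenberg p) α) π, ?_, (conj_eq _ _).1 rfl⟩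
    exact h.le (Subgroup.mem_map_of_mem _ hπ)
  · intro h
    refine Subgroup.eq_of_le_of_card_ge ?_ ?_
    · rintro _ ⟨π, hπ, rfl⟩
      obtain ⟨π', hπ', e⟩ := h π hπ
      have := (conj_eq π π').2 e
      change MulAut.conj (MulAut.toPerm (Heisenberg p) α) π ∈ G
      rwa [this]
    · exact (Nat.card_congr (G.equivMapOfInjective _
        (MulAut.conj (MulAut.toPerm (Heisenberg p) α)).injective).toEquiv).le

theorem autConj_auto_iff [Fact p.Prime] (hp : p ≠ 2) {u₂ u₃ : ZMod p}
    (a b c d l m : ZMod p) (hD : a * d - b * c ≠ 0) :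
    autConj p (auto hp a b c d l m hD) (shearSubgroup u₂ u₃) = shearSubgroup u₂ u₃ ↔
      c = -u₃ * b ∧ d = a + u₂ * b := by
  have h2 := two_ne_zero_zmod hp
  rw [autConj_eq_iff]
  constructor
  · intro h
    obtain ⟨_, ⟨s, t, r, rfl⟩, e⟩ := h (shear u₂ u₃ 1 0 0) ⟨_, _, _, rfl⟩
    have e₀ := e 1
    have e₁ := congrArg Heisenberg.z (e σ)
    have e₂ := congrArg Heisenberg.z (e τ)
    simp only [auto_apply, shear_apply, one_x, one_y, one_z, σ, τ, Heisenberg.mk.injEq]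
      at e₀ e₁ e₂
    obtain ⟨hx, hy, hz⟩ := e₀
    have hs : s = a - u₂ * t := by linear_combination -hx
    have hc : c = u₃ * t := by linear_combination hy
    subst hs hc
    field_simp at e₁ e₂ hz
    have f₁ : a * d - b * (u₃ * t) = a ^ 2 - u₂ * a * t + u₃ * t ^ 2 := by
      apply mul_left_cancel₀ h2
      linear_combination e₁ - hz
    have f₂ : a * b + t * (d - u₂ * b) = 0 := by
      apply mul_left_cancel₀ h2
      linear_combination hz - e₂
    have ht : b + t = 0 := (mul_eq_zero.1
      (show (a * d - b * (u₃ * t)) * (b + t) = 0 by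
        linear_combination (b + t) * f₁ + a * f₂ - t * f₁)).resolve_left hD
    have hd : d - u₂ * b - a = 0 := (mul_eq_zero.1
      (show (a * d - b * (u₃ * t)) * (d - u₂ * b - a) = 0 by
        linear_combination d * (f₁ + (u₃ * t - a * u₂) * ht) -
          u₃ * t * ((d - u₂ * b) * ht - f₂))).resolve_left hD
    exact ⟨by linear_combination u₃ * ht, by linear_combination hd⟩
  · rintro ⟨rfl, rfl⟩ _ ⟨s, t, r, rfl⟩
    refine ⟨_, ⟨a * s + b * u₃ * t + u₂ * b * s, a * t - b * s,
      (auto hp a b (-u₃ * b) (a + u₂ * b) l m hD ⟨s + u₂ * t, u₃ * t, r⟩).z, rfl⟩, fun g => ?_⟩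
    simp only [auto_apply, shear_apply]
    ext <;> dsimp only
    · ring
    · ring
    · field_simp
      ring

theorem card_stabilizer [Fact p.Prime] (hp : p ≠ 2) {u₂ u₃ : ZMod p} :
    Nat.card {α : MulAut (Heisenberg p) //
      autConj p α (shearSubgroup u₂ u₃) = shearSubgroup u₂ u₃} =
    Nat.card {v : ZMod p × ZMod p // v.1 ^ 2 + u₂ * v.1 * v.2 + u₃ * v.2 ^ 2 ≠ 0} * p ^ 2 := by
  have det_eq (a b : ZMod p) :
      a * (a + u₂ * b) - b * (-u₃ * b) = a ^ 2 + u₂ * a * b + u₃ * b ^ 2 := by ring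
  let f : {v : ZMod p × ZMod p // v.1 ^ 2 + u₂ * v.1 * v.2 + u₃ * v.2 ^ 2 ≠ 0} ×
      (ZMod p × ZMod p) → {α : MulAut (Heisenberg p) //
        autConj p α (shearSubgroup u₂ u₃) = shearSubgroup u₂ u₃} := fun w =>
    ⟨auto hp w.1.1.1 w.1.1.2 (-u₃ * w.1.1.2) (w.1.1.1 + u₂ * w.1.1.2) w.2.1 w.2.2
      (by rw [det_eq]; exact w.1.2), (autConj_auto_iff hp ..).2 ⟨rfl, rfl⟩⟩
  have hf : Function.Bijective f := by
    constructor
    · rintro ⟨⟨⟨a, b⟩, hv⟩, l, m⟩ ⟨⟨⟨a', b'⟩, hv'⟩, l', m'⟩ h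
      have hσ := DFunLike.congr_fun (congrArg Subtype.val h) σ
      have hτ := DFunLike.congr_fun (congrArg Subtype.val h) τ
      simp only [f, auto_apply, σ, τ, Heisenberg.mk.injEq, mul_one, mul_zero, add_zero,
        zero_add] at hσ hτ
      obtain ⟨rfl, -, hl⟩ := hσ
      obtain ⟨rfl, -, hm⟩ := hτ
      simp at hl hm
      simp [hl, hm]
    · rintro ⟨α, hα⟩
      obtain ⟨a, b, c, d, l, m, hD, rfl⟩ := exists_eq_auto hp α
      obtain ⟨rfl, rfl⟩ := (autConj_auto_iff hp ..).1 hα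
      exact ⟨⟨⟨(a, b), by rwa [← det_eq]⟩, l, m⟩, rfl⟩
  rw [← Nat.card_eq_of_bijective f hf, Nat.card_prod, Nat.card_prod, Nat.card_zmod, sq p]

end Heisenberg

section BinaryForms

variable {p : ℕ} [Fact p.Prime]

theorem card_ne_zero_zmod : Nat.card {a : ZMod p // a ≠ 0} = p - 1 := by
  rw [Nat.card_eq_fintype_card, Fintype.card_subtype_compl, Fintype.card_subtype_eq, ZMod.card]

theorem card_form_ne_zero_of_disc_eq_zero (h2 : (2 : ZMod p) ≠ 0) {u₂ u₃ : ZMod p}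
    (h : u₂ ^ 2 - 4 * u₃ = 0) :
    Nat.card {v : ZMod p × ZMod p // v.1 ^ 2 + u₂ * v.1 * v.2 + u₃ * v.2 ^ 2 ≠ 0} =
      (p - 1) * p := by
  have form_iff (v : ZMod p × ZMod p) : v.1 ^ 2 + u₂ * v.1 * v.2 + u₃ * v.2 ^ 2 ≠ 0 ↔
      v.1 + u₂ / 2 * v.2 ≠ 0 := by
    have : v.1 ^ 2 + u₂ * v.1 * v.2 + u₃ * v.2 ^ 2 = (v.1 + u₂ / 2 * v.2) ^ 2 := by
      apply mul_left_cancel₀ (mul_ne_zero h2 h2)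
      field_simp
      linear_combination -v.2 ^ 2 * h
    rw [this]
    exact pow_ne_zero_iff two_ne_zero
  let e : {v : ZMod p × ZMod p // v.1 ^ 2 + u₂ * v.1 * v.2 + u₃ * v.2 ^ 2 ≠ 0} ≃
      {a : ZMod p // a ≠ 0} × ZMod p :=
    { toFun v := (⟨v.1.1 + u₂ / 2 * v.1.2, (form_iff _).1 v.2⟩, v.1.2)
      invFun w := ⟨(w.1.1 - u₂ / 2 * w.2, w.2), (form_iff _).2 (by simpa using w.1.2)⟩
      left_inv v := by ext <;> simp
      right_inv w := by ext <;> simp }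
  rw [Nat.card_congr e, Nat.card_prod, card_ne_zero_zmod, Nat.card_zmod]

theorem card_form_ne_zero_of_isSquare_disc (h2 : (2 : ZMod p) ≠ 0) {u₂ u₃ : ZMod p}
    (h0 : u₂ ^ 2 - 4 * u₃ ≠ 0) (h : IsSquare (u₂ ^ 2 - 4 * u₃)) :
    Nat.card {v : ZMod p × ZMod p // v.1 ^ 2 + u₂ * v.1 * v.2 + u₃ * v.2 ^ 2 ≠ 0} =
      (p - 1) ^ 2 := by
  obtain ⟨k, hk⟩ := h
  have hk0 : k ≠ 0 := by
    rintro rfl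
    exact h0 (by simpa using hk)
  have form_iff (v : ZMod p × ZMod p) : v.1 ^ 2 + u₂ * v.1 * v.2 + u₃ * v.2 ^ 2 ≠ 0 ↔
      v.1 + (u₂ + k) / 2 * v.2 ≠ 0 ∧ v.1 + (u₂ - k) / 2 * v.2 ≠ 0 := by
    have : v.1 ^ 2 + u₂ * v.1 * v.2 + u₃ * v.2 ^ 2 =
        (v.1 + (u₂ + k) / 2 * v.2) * (v.1 + (u₂ - k) / 2 * v.2) := by
      apply mul_left_cancel₀ (mul_ne_zero h2 h2)
      field_simp
      linear_combination -v.2 ^ 2 * hk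
    rw [this, mul_ne_zero_iff]
  let e : {v : ZMod p × ZMod p // v.1 ^ 2 + u₂ * v.1 * v.2 + u₃ * v.2 ^ 2 ≠ 0} ≃
      {a : ZMod p // a ≠ 0} × {a : ZMod p // a ≠ 0} :=
    { toFun v := (⟨v.1.1 + (u₂ + k) / 2 * v.1.2, ((form_iff _).1 v.2).1⟩,
        ⟨v.1.1 + (u₂ - k) / 2 * v.1.2, ((form_iff _).1 v.2).2⟩)
      invFun w := ⟨(w.1.1 - (u₂ + k) / 2 * ((w.1.1 - w.2.1) / k), (w.1.1 - w.2.1) / k),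
        (form_iff _).2 ⟨by simpa using w.1.2, by
          convert w.2.2 using 1
          field_simp
          ring⟩⟩
      left_inv v := by ext <;> simp <;> field_simp <;> ring
      right_inv w := by ext <;> simp; field_simp; ring }
  rw [Nat.card_congr e, Nat.card_prod, card_ne_zero_zmod, sq]

theorem card_form_ne_zero_of_not_isSquare_disc {u₂ u₃ : ZMod p}
    (h : ¬IsSquare (u₂ ^ 2 - 4 * u₃)) :
    Nat.card {v : ZMod p × ZMod p // v.1 ^ 2 + u₂ * v.1 * v.2 + u₃ * v.2 ^ 2 ≠ 0} =
      p ^ 2 - 1 := by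
  have form_iff (v : ZMod p × ZMod p) :
      v.1 ^ 2 + u₂ * v.1 * v.2 + u₃ * v.2 ^ 2 ≠ 0 ↔ v ≠ 0 := by
    refine not_congr ⟨fun hv => ?_, fun hv => by simp [hv]⟩
    have hb : v.2 = 0 := by
      by_contra hb
      refine h ⟨(2 * v.1 + u₂ * v.2) / v.2, ?_⟩
      field_simp
      linear_combination -4 * hv
    exact Prod.ext (by simpa [hb] using hv) hb
  rw [Nat.card_congr (Equiv.subtypeEquivRight form_iff), Nat.card_eq_fintype_card,
    Fintype.card_subtype_compl, Fintype.card_subtype_eq, Fintype.card_prod, ZMod.card, sq]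

end BinaryForms

/-- The stabilizer, under the conjugation action of `Aut(M₁)`, of the regular
subgroup `H = ⟨ρ, σα₁, σ^{u₂}τ^{u₃}α₃⟩` of `Hol(M₁)` (with `u₃ ≠ 0`) has cardinality
`(p − 1)p³` if `u₂² − 4u₃ = 0`, `(p − 1)²p²` if `u₂² − 4u₃` is a nonzero square, and
`(p² − 1)p²` if `u₂² − 4u₃` is a non-square. -/
theorem stabilizer_card_case_I (p : ℕ) [Fact p.Prime] (h3 : 3 < p)
    (u₂ u₃ : ZMod p) (hu₃ : u₃ ≠ 0) :
    ∀ H : Subgroup (Equiv.Perm (Heisenberg p)),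
      H = Subgroup.closure {leftMulHom p ρ,
        leftMulHom p σ * MulAut.toPerm (Heisenberg p) α₁,
        leftMulHom p (σ ^ u₂.val * τ ^ u₃.val) * MulAut.toPerm (Heisenberg p) α₃} →
      (u₂ ^ 2 - 4 * u₃ = 0 →
        Nat.card {α : MulAut (Heisenberg p) // autConj p α H = H} = (p - 1) * p ^ 3) ∧
      (u₂ ^ 2 - 4 * u₃ ≠ 0 → IsSquare (u₂ ^ 2 - 4 * u₃) →
        Nat.card {α : MulAut (Heisenberg p) // autConj p α H = H} = (p - 1) ^ 2 * p ^ 2) ∧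
      (¬IsSquare (u₂ ^ 2 - 4 * u₃) →
        Nat.card {α : MulAut (Heisenberg p) // autConj p α H = H} = (p ^ 2 - 1) * p ^ 2) := by
  rintro _ rfl
  have hp : p ≠ 2 := by omega
  have h2 := two_ne_zero_zmod hp
  rw [closure_eq_shearSubgroup, card_stabilizer hp]
  refine ⟨fun h => ?_, fun h0 h => ?_, fun h => ?_⟩
  · rw [card_form_ne_zero_of_disc_eq_zero h2 h]
    ring
  · rw [card_form_ne_zero_of_isSquare_disc h2 h0 h]
  · rw [card_form_ne_zero_of_not_isSquare_disc h]
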